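/- arXiv:1505.05737 — 2 statements merged into one kernel-verified Lean document; each statement's English description precedes it below -/
import Mathlib

section
/- Let u^1, …, u^J be concave utility functions on finite nonempty sets A^1, …, A^J ⊂ ℤ^n, and let a* ∈ conv(A) ∩ ℤ^n where A = A^1 + ⋯ + A^J. Consider the linear program: maximize Σ_{j=1}^J Σ_{a ∈ A^j} y(a,j) u^j(a) over real variables y(a,j) ≥ 0 subject to Σ_{a ∈ A^j} y(a,j) = 1 for each j and Σ_{j} Σ_{a ∈ A^j} y(a,j) a = a*. Then competitive equilibrium exists at a* if and only if the optimal value of this linear program equals the optimal value of the same program with the added constraint that every y(a,j) lies in {0,1} (where the maximum over an empty feasible set is taken to be −∞). -/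
open Pointwise

/-- Coercion of an integer vector to a real vector. -/
def intCoe {n : ℕ} (x : Fin n → ℤ) : Fin n → ℝ := fun i => (x i : ℝ)

/-- Dot product of a real price vector with an integer bundle. -/
noncomputable def dotP {n : ℕ} (p : Fin n → ℝ) (a : Fin n → ℤ) : ℝ := ∑ i, p i * (a i : ℝ)

/-- The demand set of an agent with bundle set `A` and utility `u` at price `p`. -/
def demandSet {n : ℕ} (A : Finset (Fin n → ℤ)) (u : (Fin n → ℤ) → ℝ) (p : Fin n → ℝ) :
    Set (Fin n → ℤ) :=
  {a | a ∈ A ∧ ∀ b ∈ A, u b - dotP p b ≤ u a - dotP p a}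

/-- Aggregate demand set: the Minkowski sum of the individual demand sets. -/
def aggDemand {n J : ℕ} (A : Fin J → Finset (Fin n → ℤ)) (u : Fin J → (Fin n → ℤ) → ℝ)
    (p : Fin n → ℝ) : Set (Fin n → ℤ) :=
  {x | ∃ f : Fin J → (Fin n → ℤ), (∀ j, f j ∈ demandSet (A j) (u j) p) ∧ ∑ j, f j = x}

/-- Aggregate domain: the Minkowski sum of the bundle sets. -/
def aggDomain {n J : ℕ} (A : Fin J → Finset (Fin n → ℤ)) : Set (Fin n → ℤ) :=
  {x | ∃ f : Fin J → (Fin n → ℤ), (∀ j, f j ∈ A j) ∧ ∑ j, f j = x}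

/-- Aggregate utility. -/
noncomputable def aggU {n J : ℕ} (A : Fin J → Finset (Fin n → ℤ)) (u : Fin J → (Fin n → ℤ) → ℝ)
    (a : Fin n → ℤ) : ℝ :=
  sSup {t | ∃ f : Fin J → (Fin n → ℤ), (∀ j, f j ∈ A j) ∧ ∑ j, f j = a ∧ t = ∑ j, u j (f j)}

/-- A vector in `ℤ^n` is primitive if the gcd of its coordinates is 1. -/
def IsPrimitive {n : ℕ} (v : Fin n → ℤ) : Prop := Finset.univ.gcd v = 1

/-- A set of integer vectors is unimodular if every linearly independent subset of `n` of its
vectors is a `ℤ`-basis of `ℤ^n`. -/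
def IsUnimodular {n : ℕ} (D : Set (Fin n → ℤ)) : Prop :=
  ∀ s : Finset (Fin n → ℤ), ↑s ⊆ D → s.card = n →
    LinearIndependent ℤ (fun x : (s : Set (Fin n → ℤ)) => (x : Fin n → ℤ)) →
    Submodule.span ℤ (s : Set (Fin n → ℤ)) = ⊤

/-- Every edge (one-dimensional face, i.e. extreme segment) of `P` is parallel to a vector of `D`. -/
def EdgesParallelTo {n : ℕ} (P : Set (Fin n → ℝ)) (D : Set (Fin n → ℤ)) : Prop :=
  ∀ x y : Fin n → ℝ, x ≠ y → IsExtreme ℝ P (segment ℝ x y) →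
    ∃ v ∈ D, ∃ t : ℝ, y - x = t • intCoe v

/-- A utility function is of demand type `D` if every edge of every demand-set polytope is
parallel to a vector of `D`. -/
def IsDemandType {n : ℕ} (A : Finset (Fin n → ℤ)) (u : (Fin n → ℤ) → ℝ)
    (D : Set (Fin n → ℤ)) : Prop :=
  ∀ p : Fin n → ℝ, EdgesParallelTo (convexHull ℝ (intCoe '' demandSet A u p)) D

/-- A utility function on `A` is concave if `A` contains all lattice points of its convex hull
and `u` is the restriction of a concave function on `conv(A)`. -/
def IsConcaveUtility {n : ℕ} (A : Finset (Fin n → ℤ)) (u : (Fin n → ℤ) → ℝ) : Prop :=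
  (∀ x : Fin n → ℤ, intCoe x ∈ convexHull ℝ (intCoe '' (A : Set (Fin n → ℤ))) → x ∈ A) ∧
  ∃ f : (Fin n → ℝ) → ℝ,
    ConcaveOn ℝ (convexHull ℝ (intCoe '' (A : Set (Fin n → ℤ)))) f ∧
    ∀ a ∈ A, f (intCoe a) = u a

/-- The concave majorant of a function on a finite set of lattice points. -/
noncomputable def concaveMajorant {n : ℕ} (A : Finset (Fin n → ℤ)) (f : (Fin n → ℤ) → ℝ)
    (x : Fin n → ℝ) : ℝ :=
  sSup {t | ∃ lam : (Fin n → ℤ) → ℝ, (∀ d ∈ A, 0 ≤ lam d) ∧ (∑ d ∈ A, lam d) = 1 ∧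
    (∑ d ∈ A, lam d • intCoe d) = x ∧ t = ∑ d ∈ A, lam d * f d}

/-- The aggregate domain as a finite set. -/
def aggFinset {n J : ℕ} (A : Fin J → Finset (Fin n → ℤ)) : Finset (Fin n → ℤ) :=
  Finset.image (fun f => ∑ j, f j) (Fintype.piFinset A)

/-- **Farkas' lemma**: a linear functional that is nonpositive wherever finitely many given
functionals are nonpositive is a nonnegative combination of them. -/
theorem exists_nonneg_combination_of_forall_nonpos {E ι : Type*} [AddCommGroup E] [Module ℝ E]
    (s : Finset ι) (f : ι → E →ₗ[ℝ] ℝ) (g : E →ₗ[ℝ] ℝ)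
    (h : ∀ x, (∀ i ∈ s, f i x ≤ 0) → g x ≤ 0) :
    ∃ c : ι → ℝ, (∀ i ∈ s, 0 ≤ c i) ∧ ∀ x, g x = ∑ i ∈ s, c i * f i x := by
  classical
  induction s using Finset.induction_on generalizing f g with
  | empty =>
    refine ⟨0, by simp, fun x => ?_⟩
    have h₁ := h x (by simp)
    have h₂ := h (-x) (by simp)
    simp only [map_neg] at h₂
    simp only [Finset.sum_empty]
    linarith
  | insert k s hk ih =>
    by_cases hg : ∀ x, (∀ i ∈ s, f i x ≤ 0) → g x ≤ 0
    · obtain ⟨c, hc, hgc⟩ := ih f g hg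
      refine ⟨Function.update c k 0, fun i hi => ?_, fun x => ?_⟩
      · rcases Finset.mem_insert.1 hi with rfl | his
        · simp
        · rw [Function.update_of_ne (by rintro rfl; exact hk his)]
          exact hc i his
      · rw [Finset.sum_insert hk, hgc]
        simp only [Function.update_self, zero_mul, zero_add]
        exact Finset.sum_congr rfl fun i hi => by
          rw [Function.update_of_ne (by rintro rfl; exact hk hi)]
    · push Not at hg
      obtain ⟨x, hx, hgx⟩ := hg
      have hfx : 0 < f k x := by
        by_contra! hle
        exact hgx.not_ge (h x (Finset.forall_mem_insert .. |>.2 ⟨hle, hx⟩))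
      let r (φ : E →ₗ[ℝ] ℝ) : E →ₗ[ℝ] ℝ := φ - (φ x / f k x) • f k
      have r_apply (φ : E →ₗ[ℝ] ℝ) (y : E) : r φ y = φ y - φ x / f k x * f k y := by
        simp [r]
      have r_eq (φ : E →ₗ[ℝ] ℝ) (y : E) : r φ y = φ (y - (f k y / f k x) • x) := by
        rw [r_apply, map_sub, map_smul, smul_eq_mul]
        ring
      obtain ⟨c, hc, hgc⟩ := ih (fun i => r (f i)) (r g) fun y hy => by
        rw [r_eq]
        refine h _ (Finset.forall_mem_insert .. |>.2 ⟨?_, fun i hi => ?_⟩)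
        · rw [← r_eq, r_apply, div_self hfx.ne']
          simp
        · rw [← r_eq]
          exact hy i hi
      refine ⟨Function.update c k (g x / f k x - ∑ i ∈ s, c i * (f i x / f k x)),
        fun i hi => ?_, fun y => ?_⟩
      · rcases Finset.mem_insert.1 hi with rfl | his
        · rw [Function.update_self, sub_nonneg]
          exact (Finset.sum_nonpos fun j hj => mul_nonpos_of_nonneg_of_nonpos (hc j hj)
            (div_nonpos_of_nonpos_of_nonneg (hx j hj) hfx.le)).trans (div_pos hgx hfx).le
        · rw [Function.update_of_ne (by rintro rfl; exact hk his)]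
          exact hc i his
      · have key := hgc y
        simp only [r_apply] at key
        rw [Finset.sum_insert hk, Function.update_self]
        have hs : ∑ i ∈ s, Function.update c k
            (g x / f k x - ∑ i ∈ s, c i * (f i x / f k x)) i * f i y =
            ∑ i ∈ s, c i * f i y := Finset.sum_congr rfl fun i hi => by
          rw [Function.update_of_ne (by rintro rfl; exact hk hi)]
        have hd : ∑ i ∈ s, c i * (f i y - f i x / f k x * f k y) =
            ∑ i ∈ s, c i * f i y - (∑ i ∈ s, c i * (f i x / f k x)) * f k y := by
          rw [Finset.sum_mul, ← Finset.sum_sub_distrib]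
          exact Finset.sum_congr rfl fun i _ => by ring
        rw [hs]
        rw [hd] at key
        linarith

theorem intCoe_sum {n J : ℕ} (f : Fin J → Fin n → ℤ) :
    intCoe (∑ j, f j) = ∑ j, intCoe (f j) := by
  ext i
  simp [intCoe]

theorem intCoe_injective {n : ℕ} : Function.Injective (intCoe : (Fin n → ℤ) → Fin n → ℝ) :=
  fun x y h => by
    ext i
    exact Int.cast_injective (α := ℝ) (congrFun h i)

theorem dotP_eq_dotProduct {n : ℕ} (p : Fin n → ℝ) (a : Fin n → ℤ) :
    dotP p a = p ⬝ᵥ intCoe a := rfl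

/-- Feasible points of the linear program for the target `x`. -/
def IsFractionalAllocation {n J : ℕ} (A : Fin J → Finset (Fin n → ℤ)) (x : Fin n → ℝ)
    (y : Fin J → (Fin n → ℤ) → ℝ) : Prop :=
  (∀ j, ∀ a ∈ A j, 0 ≤ y j a) ∧ (∀ j, (∑ a ∈ A j, y j a) = 1) ∧
    (∑ j, ∑ a ∈ A j, y j a • intCoe a) = x

section

variable {n J : ℕ} {A : Fin J → Finset (Fin n → ℤ)} {f : Fin J → Fin n → ℤ}

theorem sum_indicator_eq_one (hf : ∀ j, f j ∈ A j) (j : Fin J) :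
    ∑ a ∈ A j, (if a = f j then (1 : ℝ) else 0) = 1 := by
  simp [hf j]

theorem sum_indicator_smul {E : Type*} [AddCommGroup E] [Module ℝ E]
    (hf : ∀ j, f j ∈ A j) (F : Fin J → (Fin n → ℤ) → E) :
    ∑ j, ∑ a ∈ A j, (if a = f j then (1 : ℝ) else 0) • F j a = ∑ j, F j (f j) := by
  simp [ite_smul, hf]

theorem sum_indicator_mul (hf : ∀ j, f j ∈ A j) (F : Fin J → (Fin n → ℤ) → ℝ) :
    ∑ j, ∑ a ∈ A j, (if a = f j then (1 : ℝ) else 0) * F j a = ∑ j, F j (f j) :=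
  sum_indicator_smul hf F

theorem isFractionalAllocation_indicator (hf : ∀ j, f j ∈ A j) :
    IsFractionalAllocation A (intCoe (∑ j, f j)) fun j a => if a = f j then 1 else 0 := by
  refine ⟨fun j a _ => ?_, sum_indicator_eq_one hf, ?_⟩
  · dsimp only
    split_ifs <;> norm_num
  · rw [sum_indicator_smul hf fun _ a => intCoe a, intCoe_sum]

/-- A 0/1 allocation assigns a single bundle to each agent. -/
theorem exists_eq_indicator {y : Fin J → (Fin n → ℤ) → ℝ}
    (h01 : ∀ j, ∀ a ∈ A j, y j a = 0 ∨ y j a = 1) (hsum : ∀ j, ∑ a ∈ A j, y j a = 1) :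
    ∃ f : Fin J → Fin n → ℤ, (∀ j, f j ∈ A j) ∧
      ∀ j, ∀ a ∈ A j, y j a = if a = f j then 1 else 0 := by
  have hex (j : Fin J) : ∃ a ∈ A j, y j a = 1 := by
    by_contra! hne
    have := Finset.sum_eq_zero fun a ha => (h01 j a ha).resolve_right (hne a ha)
    linarith [hsum j]
  choose f hf hyf using hex
  refine ⟨f, hf, fun j a ha => ?_⟩
  split_ifs with h
  · rw [h, hyf]
  · have hrest : ∑ b ∈ (A j).erase (f j), y j b = 0 := by
      have := Finset.add_sum_erase (A j) (y j) (hf j)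
      linarith [hsum j, hyf j]
    refine (Finset.sum_eq_zero_iff_of_nonneg fun b hb => ?_).1 hrest a
      (Finset.mem_erase.2 ⟨h, ha⟩)
    rcases h01 j b (Finset.mem_of_mem_erase hb) with h | h <;> simp [h]

/-- Points in the convex hull of the aggregate domain admit a fractional allocation. -/
theorem exists_isFractionalAllocation {x : Fin n → ℝ}
    (hx : x ∈ convexHull ℝ (intCoe '' aggDomain A)) :
    ∃ y, IsFractionalAllocation A x y := by
  refine convexHull_min (t := {x | ∃ y, IsFractionalAllocation A x y}) ?_ ?_ hx
  · rintro _ ⟨_, ⟨f, hf, rfl⟩, rfl⟩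
    exact ⟨_, isFractionalAllocation_indicator hf⟩
  · rintro x ⟨y, hy0, hy1, rfl⟩ x' ⟨y', hy0', hy1', rfl⟩ s t hs ht hst
    refine ⟨fun j a => s * y j a + t * y' j a, fun j a ha => ?_, fun j => ?_, ?_⟩
    · have := hy0 j a ha
      have := hy0' j a ha
      positivity
    · rw [Finset.sum_add_distrib, ← Finset.mul_sum, ← Finset.mul_sum, hy1, hy1']
      linarith
    · simp only [add_smul, Finset.sum_add_distrib, mul_smul, Finset.smul_sum]

variable {u : Fin J → (Fin n → ℤ) → ℝ}

/-- An equilibrium allocation is optimal among fractional allocations. -/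
theorem IsFractionalAllocation.sum_le {p : Fin n → ℝ} {y : Fin J → (Fin n → ℤ) → ℝ}
    (hy : IsFractionalAllocation A (intCoe (∑ j, f j)) y)
    (hf : ∀ j, f j ∈ demandSet (A j) (u j) p) :
    ∑ j, ∑ a ∈ A j, y j a * u j a ≤ ∑ j, u j (f j) := by
  obtain ⟨hy0, hy1, hyx⟩ := hy
  have hle : ∑ j, ∑ a ∈ A j, y j a * (u j a - dotP p a) ≤
      ∑ j, (u j (f j) - dotP p (f j)) := by
    refine Finset.sum_le_sum fun j _ => ?_
    calc ∑ a ∈ A j, y j a * (u j a - dotP p a)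
        ≤ ∑ a ∈ A j, y j a * (u j (f j) - dotP p (f j)) :=
          Finset.sum_le_sum fun a ha =>
            mul_le_mul_of_nonneg_left ((hf j).2 a ha) (hy0 j a ha)
      _ = u j (f j) - dotP p (f j) := by rw [← Finset.sum_mul, hy1, one_mul]
  have hp := congrArg (p ⬝ᵥ ·) hyx
  simp only [intCoe_sum, dotProduct_sum, dotProduct_smul, smul_eq_mul,
    ← dotP_eq_dotProduct] at hp
  simp only [mul_sub, Finset.sum_sub_distrib] at hle
  linarith

/-- An integral allocation that is optimal among fractional allocations is supported by prices. -/
theorem exists_price_of_forall_sum_le (hf : ∀ j, f j ∈ A j)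
    (hopt : ∀ y, IsFractionalAllocation A (intCoe (∑ j, f j)) y →
      ∑ j, ∑ a ∈ A j, y j a * u j a ≤ ∑ j, u j (f j)) :
    ∃ p, ∀ j, f j ∈ demandSet (A j) (u j) p := by
  by_contra! hno
  let φ (i : Σ _ : Fin J, Fin n → ℤ) : (Fin n → ℝ) × ℝ →ₗ[ℝ] ℝ :=
    (dotProductBilin ℝ ℝ (intCoe i.2 - intCoe (f i.1))).comp (LinearMap.fst ℝ _ _) +
      (u i.1 i.2 - u i.1 (f i.1)) • LinearMap.snd ℝ _ _
  have φ_apply (j : Fin J) (a : Fin n → ℤ) (q : Fin n → ℝ) (t : ℝ) :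
      φ ⟨j, a⟩ (q, t) = dotP q a - dotP q (f j) + (u j a - u j (f j)) * t := by
    simp [φ, dotP_eq_dotProduct, dotProduct_comm q]
  obtain ⟨c, hc, hsum⟩ := exists_nonneg_combination_of_forall_nonpos
    (Finset.univ.sigma A) φ (LinearMap.snd ℝ _ _) fun ⟨q, t⟩ hx => by
      by_contra! ht
      simp only [LinearMap.snd_apply] at ht
      obtain ⟨j, hj⟩ := hno (-(t⁻¹ • q))
      refine hj ⟨hf j, fun b hb => ?_⟩
      have h := hx ⟨j, b⟩ (by simpa using hb)
      rw [φ_apply] at h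
      have h' := mul_nonpos_of_nonneg_of_nonpos (inv_pos.2 ht).le h
      simp only [dotP_eq_dotProduct, neg_dotProduct, smul_dotProduct, smul_eq_mul] at h' ⊢
      have : t⁻¹ * ((u j b - u j (f j)) * t) = u j b - u j (f j) := by field_simp
      rw [mul_add, this] at h'
      linarith
  replace hc (j : Fin J) (a : Fin n → ℤ) (ha : a ∈ A j) : 0 ≤ c ⟨j, a⟩ :=
    hc _ (by simpa using ha)
  have hut : ∑ j, ∑ a ∈ A j, c ⟨j, a⟩ * (u j a - u j (f j)) = 1 := by
    have := hsum (0, 1)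
    simp only [Finset.sum_sigma, φ_apply] at this
    simpa [dotP] using this.symm
  have hbal : ∑ j, ∑ a ∈ A j, c ⟨j, a⟩ • (intCoe a - intCoe (f j)) = 0 := by
    refine dotProduct_eq_zero_iff.1 fun q => ?_
    have := hsum (q, 0)
    simp only [Finset.sum_sigma, φ_apply] at this
    simpa [dotP_eq_dotProduct, sum_dotProduct, sub_dotProduct, dotProduct_comm q]
      using this.symm
  set C := ∑ j, ∑ a ∈ A j, c ⟨j, a⟩
  have hcj (j : Fin J) : 0 ≤ ∑ a ∈ A j, c ⟨j, a⟩ := Finset.sum_nonneg (hc j)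
  have hC0 : 0 ≤ C := Finset.sum_nonneg fun j _ => hcj j
  have hcC (j : Fin J) : ∑ a ∈ A j, c ⟨j, a⟩ ≤ C :=
    Finset.single_le_sum (f := fun j => ∑ a ∈ A j, c ⟨j, a⟩)
      (fun j _ => hcj j) (Finset.mem_univ j)
  set ε := (1 + C)⁻¹ with hε
  have hε0 : 0 < ε := by positivity
  let y (j : Fin J) (a : Fin n → ℤ) : ℝ :=
    ε * c ⟨j, a⟩ + (1 - ε * ∑ b ∈ A j, c ⟨j, b⟩) * if a = f j then 1 else 0
  have sum_y_smul {E : Type} [AddCommGroup E] [Module ℝ E] (F : Fin J → (Fin n → ℤ) → E) :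
      ∑ j, ∑ a ∈ A j, y j a • F j a = ∑ j, F j (f j) +
        ε • ∑ j, ∑ a ∈ A j, c ⟨j, a⟩ • (F j a - F j (f j)) := by
    rw [Finset.smul_sum, ← Finset.sum_add_distrib]
    refine Finset.sum_congr rfl fun j _ => ?_
    simp only [y, add_smul, Finset.sum_add_distrib, mul_smul, smul_sub,
      Finset.sum_sub_distrib, ite_smul, one_smul, zero_smul, smul_ite, smul_zero,
      Finset.sum_ite_eq', hf j, if_true, sub_smul, Finset.sum_smul, Finset.smul_sum]
    abel
  have hy : IsFractionalAllocation A (intCoe (∑ j, f j)) y := by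
    refine ⟨fun j a ha => ?_, fun j => ?_, ?_⟩
    · have h1 : ε * ∑ b ∈ A j, c ⟨j, b⟩ ≤ 1 := by
        rw [hε, inv_mul_le_iff₀ (by positivity)]
        linarith [hcC j]
      have h2 := hc j a ha
      refine add_nonneg (mul_nonneg hε0.le h2) (mul_nonneg (sub_nonneg.2 h1) ?_)
      split_ifs <;> norm_num
    · simp only [y]
      rw [Finset.sum_add_distrib, ← Finset.mul_sum, ← Finset.mul_sum, sum_indicator_eq_one hf]
      ring
    · rw [sum_y_smul fun _ a => intCoe a, hbal, smul_zero, add_zero, intCoe_sum]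
  have hval := hopt y hy
  have hval' := sum_y_smul u
  simp only [smul_eq_mul, hut] at hval'
  linarith

end

/-- competitive equilibrium exists at `a*` iff the optimal value of the assignment
linear program equals the optimal value of the corresponding 0/1 integer program (values taken
in `EReal`, so an empty feasible set has value `-∞`). -/
theorem stmt6 {n J : ℕ} (A : Fin J → Finset (Fin n → ℤ)) (u : Fin J → (Fin n → ℤ) → ℝ)
    (hA : ∀ j, (A j).Nonempty) (hconc : ∀ j, IsConcaveUtility (A j) (u j))
    (astar : Fin n → ℤ)
    (hastar : intCoe astar ∈ convexHull ℝ (intCoe '' aggDomain A)) :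
    (∃ p : Fin n → ℝ, astar ∈ aggDemand A u p) ↔
      sSup {t : EReal | ∃ y : Fin J → (Fin n → ℤ) → ℝ,
          (∀ j, ∀ a ∈ A j, 0 ≤ y j a) ∧ (∀ j, (∑ a ∈ A j, y j a) = 1) ∧
          (∑ j, ∑ a ∈ A j, y j a • intCoe a) = intCoe astar ∧
          t = ((∑ j, ∑ a ∈ A j, y j a * u j a : ℝ) : EReal)} =
      sSup {t : EReal | ∃ y : Fin J → (Fin n → ℤ) → ℝ,
          (∀ j, ∀ a ∈ A j, y j a = 0 ∨ y j a = 1) ∧ (∀ j, (∑ a ∈ A j, y j a) = 1) ∧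
          (∑ j, ∑ a ∈ A j, y j a • intCoe a) = intCoe astar ∧
          t = ((∑ j, ∑ a ∈ A j, y j a * u j a : ℝ) : EReal)} := by
  constructor
  · rintro ⟨p, f, hf, rfl⟩
    have hfA (j) : f j ∈ A j := (hf j).1
    have hind := isFractionalAllocation_indicator hfA
    apply le_antisymm
    · refine (sSup_le ?_).trans (le_sSup ⟨fun j a => if a = f j then 1 else 0,
        fun j a _ => ?_, hind.2.1, hind.2.2, rfl⟩)
      · rintro _ ⟨y, hy0, hy1, hyx, rfl⟩
        rw [sum_indicator_mul hfA u]
        exact EReal.coe_le_coe_iff.2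
          (IsFractionalAllocation.sum_le (u := u) ⟨hy0, hy1, hyx⟩ hf)
      · dsimp only
        split_ifs <;> simp
    · refine sSup_le_sSup ?_
      rintro _ ⟨y, h01, hy1, hyx, rfl⟩
      exact ⟨y, fun j a ha => by rcases h01 j a ha with h | h <;> simp [h], hy1, hyx, rfl⟩
  · intro heq
    set I := {t : EReal | ∃ y : Fin J → (Fin n → ℤ) → ℝ,
      (∀ j, ∀ a ∈ A j, y j a = 0 ∨ y j a = 1) ∧ (∀ j, (∑ a ∈ A j, y j a) = 1) ∧
      (∑ j, ∑ a ∈ A j, y j a • intCoe a) = intCoe astar ∧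
      t = ((∑ j, ∑ a ∈ A j, y j a * u j a : ℝ) : EReal)}
    have hmem : ∀ t ∈ I, ∃ f : Fin J → Fin n → ℤ, (∀ j, f j ∈ A j) ∧ ∑ j, f j = astar ∧
        ((∑ j, u j (f j) : ℝ) : EReal) = t := by
      rintro _ ⟨y, h01, hy1, hyx, rfl⟩
      obtain ⟨f, hf, hyf⟩ := exists_eq_indicator h01 hy1
      refine ⟨f, hf, intCoe_injective ?_, ?_⟩
      · rw [← hyx, intCoe_sum, ← sum_indicator_smul hf fun _ a => intCoe a]
        exact Finset.sum_congr rfl fun j _ => Finset.sum_congr rfl fun a ha => by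
          rw [hyf j a ha]
      · rw [← sum_indicator_mul hf u]
        exact congrArg _ (Finset.sum_congr rfl fun j _ => Finset.sum_congr rfl fun a ha => by
          rw [hyf j a ha])
    have hle {y} (hy : IsFractionalAllocation A (intCoe astar) y) :
        ((∑ j, ∑ a ∈ A j, y j a * u j a : ℝ) : EReal) ≤ sSup I := by
      rw [← heq]
      exact le_sSup ⟨y, hy.1, hy.2.1, hy.2.2, rfl⟩
    have hne : I.Nonempty := by
      obtain ⟨y, hy⟩ := exists_isFractionalAllocation hastar
      rw [Set.nonempty_iff_ne_empty]
      intro hemp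
      have h := hle hy
      rw [hemp, sSup_empty, le_bot_iff] at h
      exact EReal.coe_ne_bot _ h
    have hfin : I.Finite := by
      refine ((Fintype.piFinset A).finite_toSet.image
        fun f => ((∑ j, u j (f j) : ℝ) : EReal)).subset fun t ht => ?_
      obtain ⟨f, hf, -, rfl⟩ := hmem t ht
      exact ⟨f, by simpa using hf, rfl⟩
    obtain ⟨f, hf, rfl, hval⟩ := hmem _ (hne.csSup_mem hfin)
    obtain ⟨p, hp⟩ := exists_price_of_forall_sum_le (u := u) hf fun y hy =>
      EReal.coe_le_coe_iff.1 ((hle hy).trans_eq hval.symm)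
    exact ⟨p, f, hp, rfl⟩
end

section
/- Let D be a set of primitive vectors in ℤ^n and let u^1, …, u^J be utility functions on finite nonempty sets A^1, …, A^J ⊂ ℤ^n. The aggregate is of demand type D — i.e., for every p ∈ ℝ^n, every edge of conv(D_U(p)) is parallel to some vector of D, where D_U(p) = D_{u^1}(p) + ⋯ + D_{u^J}(p) — if and only if u^j is of demand type D for every j = 1, …, J. -/
open Pointwise

section Edges

variable {E : Type*} [NormedAddCommGroup E] [NormedSpace ℝ E]

/-- A nontrivial compact convex set contained in a line is a segment. -/
lemma exists_eq_segment_of_sub_mem_span {F : Set E} (hk : IsCompact F) (hc : Convex ℝ F)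
    (hF : F.Nontrivial) {d : E} (hd : d ≠ 0)
    (hline : ∀ a ∈ F, ∀ b ∈ F, b - a ∈ Submodule.span ℝ {d}) :
    ∃ a b, a ≠ b ∧ F = segment ℝ a b ∧ b - a ∈ Submodule.span ℝ {d} := by
  obtain ⟨f, hf⟩ := SeparatingDual.exists_eq_one (R := ℝ) hd
  have key : ∀ a ∈ F, ∀ b ∈ F, b = a + (f b - f a) • d := by
    intro a ha b hb
    obtain ⟨t, ht⟩ := Submodule.mem_span_singleton.1 (hline a ha b hb)
    have : f b - f a = t := by rw [← map_sub, ← ht]; simp [hf]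
    rw [this, ht]; abel
  obtain ⟨a, ha, hmin⟩ := hk.exists_isMinOn hF.nonempty f.continuous.continuousOn
  obtain ⟨b, hb, hmax⟩ := hk.exists_isMaxOn hF.nonempty f.continuous.continuousOn
  have hab : f a < f b := by
    obtain ⟨p, hp, q, hq, hpq⟩ := hF
    refine lt_of_le_of_ne ((hmin hp).trans (hmax hp)) fun h => hpq ?_
    have h1 : f p = f a := le_antisymm ((hmax hp).trans h.ge) (hmin hp)
    have h2 : f q = f a := le_antisymm ((hmax hq).trans h.ge) (hmin hq)
    rw [key p hp q hq, h1, h2]; simp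
  refine ⟨a, b, fun h => hab.ne (by rw [h]), ?_, hline a ha b hb⟩
  refine Set.Subset.antisymm (fun z hz => ?_) (hc.segment_subset ha hb)
  have hpos : 0 < f b - f a := sub_pos.2 hab
  rw [segment_eq_image']
  refine ⟨(f z - f a) / (f b - f a), ⟨div_nonneg (sub_nonneg.2 (hmin hz)) hpos.le,
    (div_le_one hpos).2 (sub_le_sub_right (hmax hz) _)⟩, ?_⟩
  have hba : b - a = (f b - f a) • d := by
    nth_rewrite 1 [key a ha b hb]; abel
  simp only
  rw [hba, smul_smul, div_mul_cancel₀ _ hpos.ne', ← key a ha z hz]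

/-- An extreme segment is the whole section of the set by its line. -/
lemma IsExtreme.mem_segment_of_sub_mem_span {P : Set E} {x y z : E}
    (h : IsExtreme ℝ P (segment ℝ x y)) (hz : z ∈ P)
    (hzx : z - x ∈ Submodule.span ℝ {y - x}) : z ∈ segment ℝ x y := by
  obtain ⟨t, ht⟩ := Submodule.mem_span_singleton.1 hzx
  have hz' : z = x + t • (y - x) := by rw [ht]; abel
  have hx := left_mem_segment ℝ x y
  have hy := right_mem_segment ℝ x y
  rcases lt_or_ge t 0 with h0 | h0
  · refine h.left_mem_of_mem_openSegment hz (h.subset hy) hx ?_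
    rw [openSegment_eq_image']
    have hd : 1 - t ≠ 0 := by linarith
    refine ⟨-t / (1 - t), ⟨div_pos (by linarith) (by linarith),
      (div_lt_one (by linarith)).2 (by linarith)⟩, ?_⟩
    simp only
    rw [hz']
    match_scalars <;> field_simp <;> ring
  rcases le_or_gt t 1 with h1 | h1
  · rw [segment_eq_image']
    exact ⟨t, ⟨h0, h1⟩, hz'.symm⟩
  · refine h.left_mem_of_mem_openSegment hz (h.subset hx) hy ?_
    rw [openSegment_eq_image']
    have hd : t ≠ 0 := by linarith
    refine ⟨(t - 1) / t, ⟨div_pos (by linarith) (by linarith),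
      (div_lt_one (by linarith)).2 (by linarith)⟩, ?_⟩
    simp only
    rw [hz']
    match_scalars <;> field_simp <;> ring

/-- The set where a linear map takes a given value that is extreme in the image is an extreme
subset. -/
lemma isExtreme_fiber {M : Set E} (π : E →L[ℝ] E) {w : E}
    (hw : w ∈ (π '' M).extremePoints ℝ) : IsExtreme ℝ M {z ∈ M | π z = w} := by
  refine ⟨fun z hz => hz.1, fun a ha b hb z hz hab => ⟨ha, ?_⟩⟩
  refine hw.2 (Set.mem_image_of_mem π ha) (Set.mem_image_of_mem π hb) ?_
  rw [← hz.2]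
  have := Set.mem_image_of_mem π hab
  rwa [← ContinuousLinearMap.coe_coe π, ← LinearMap.coe_toAffineMap, image_openSegment] at this

variable {ι : Type*} [Fintype ι]

/-- Replacing one summand of an element of a Minkowski sum. -/
lemma sum_sub_add_mem_sum {G : Type*} [AddCommGroup G] {Q : ι → Set G} {q : ι → G} (hq : ∀ i, q i ∈ Q i) (j : ι)
    {a : G} (ha : a ∈ Q j) : ∑ i, q i - q j + a ∈ ∑ i, Q i := by
  classical
  refine (Set.mem_fintype_sum _ _).2 ⟨Function.update q j a, fun i => ?_, ?_⟩
  · rcases eq_or_ne i j with rfl | hij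
    · simpa using ha
    · simpa [hij] using hq i
  · rw [Finset.sum_update_of_mem (Finset.mem_univ j),
      ← Finset.add_sum_erase Finset.univ q (Finset.mem_univ j), Finset.sdiff_singleton_eq_erase]
    abel

/-- Every edge of a Minkowski sum of compact convex sets is parallel to an edge of a summand. -/
lemma exists_parallel_edge_summand {Q : ι → Set E} (hc : ∀ i, Convex ℝ (Q i))
    (hk : ∀ i, IsCompact (Q i)) {x y : E} (hxy : x ≠ y)
    (h : IsExtreme ℝ (∑ i, Q i) (segment ℝ x y)) :
    ∃ i a b, a ≠ b ∧ IsExtreme ℝ (Q i) (segment ℝ a b) ∧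
      b - a ∈ Submodule.span ℝ {y - x} := by
  obtain ⟨f, hf, hfx⟩ := (Set.mem_fintype_sum _ _).1 (h.subset (left_mem_segment ℝ x y))
  obtain ⟨g, hg, hgy⟩ := (Set.mem_fintype_sum _ _).1 (h.subset (right_mem_segment ℝ x y))
  obtain ⟨j, hj⟩ : ∃ j, f j ≠ g j := by
    by_contra! hfg
    exact hxy (by rw [← hfx, ← hgy]; exact Finset.sum_congr rfl fun i _ => hfg i)
  set m : ι → E := fun i => midpoint ℝ (f i) (g i) with hm
  have hmQ : ∀ i, m i ∈ Q i := fun i => (hc i).midpoint_mem (hf i) (hg i)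
  have hsum : ∑ i, m i = midpoint ℝ x y := by
    simp only [hm, midpoint_eq_smul_add, ← Finset.smul_sum, Finset.sum_add_distrib, hfx, hgy]
  set c : E := ∑ i, m i - m j with hcdef
  have hQ : ∀ a ∈ Q j, c + a ∈ ∑ i, Q i := fun a ha => sum_sub_add_mem_sum hmQ j ha
  set F : Set E := {z ∈ Q j | c + z ∈ segment ℝ x y} with hFdef
  have hFext : IsExtreme ℝ (Q j) F := by
    refine ⟨fun z hz => hz.1, fun a ha b hb z hz hab => ⟨ha, ?_⟩⟩
    refine h.left_mem_of_mem_openSegment (hQ a ha) (hQ b hb) hz.2 ?_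
    exact (mem_openSegment_translate ℝ c).2 hab
  have hmF : m j ∈ F := by
    refine ⟨hmQ j, ?_⟩
    rw [hcdef, sub_add_cancel, hsum]
    exact midpoint_mem_segment x y
  have hmo : m j ∈ openSegment ℝ (f j) (g j) :=
    ⟨1 / 2, 1 / 2, by norm_num, by norm_num, by norm_num, by
      simp [hm, midpoint_eq_smul_add]⟩
  have hcF : Convex ℝ F :=
    (hc j).inter ((convex_segment x y).translate_preimage_right c)
  have hseg : IsCompact (segment ℝ x y) := by
    rw [segment_eq_image']
    exact isCompact_Icc.image (by fun_prop)
  have hkF : IsCompact F :=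
    (hk j).inter_right (hseg.isClosed.preimage (by fun_prop : Continuous fun z => c + z))
  have hnF : F.Nontrivial :=
    ⟨f j, hFext.left_mem_of_mem_openSegment (hf j) (hg j) hmF hmo, g j,
      hFext.right_mem_of_mem_openSegment (hf j) (hg j) hmF hmo, hj⟩
  obtain ⟨a, b, hab, hFab, hba⟩ := exists_eq_segment_of_sub_mem_span hkF hcF hnF
    (sub_ne_zero.2 hxy.symm) (fun a ha b hb => by
      have h1 := ha.2
      have h2 := hb.2
      rw [segment_eq_image'] at h1 h2
      obtain ⟨s, -, hs⟩ := h1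
      obtain ⟨t, -, ht⟩ := h2
      refine Submodule.mem_span_singleton.2 ⟨t - s, ?_⟩
      have : b - a = (c + b) - (c + a) := by abel
      rw [this, ← hs, ← ht]
      module)
  exact ⟨j, a, b, hab, hFab ▸ hFext, hba⟩

/-- A linear functional that is constant on an edge of a polytope, and minimal on the polytope
exactly along the line through that edge. The line is a fibre of `π`. -/
lemma exists_functional_of_edge {S : Set E} (hS : S.Finite) {x y : E}
    (h : IsExtreme ℝ (convexHull ℝ S) (segment ℝ x y)) (π : E →L[ℝ] E)
    (hker : ∀ z, π z = 0 ↔ z ∈ Submodule.span ℝ {y - x}) :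
    ∃ f : StrongDual ℝ E, ∀ z ∈ convexHull ℝ S, π z = π x ∨ f (π x) < f (π z) := by
  have hfib : ∀ z ∈ convexHull ℝ S, π z = π x → z ∈ segment ℝ x y := fun z hz hzx =>
    h.mem_segment_of_sub_mem_span hz ((hker _).1 (by rw [map_sub, hzx, sub_self]))
  have hconst : ∀ z ∈ segment ℝ x y, π z = π x := by
    intro z hz
    rw [segment_eq_image'] at hz
    obtain ⟨t, -, rfl⟩ := hz
    have := (hker (t • (y - x))).2 (Submodule.smul_mem _ _ (Submodule.mem_span_singleton_self _))
    simp only [map_add, this, add_zero]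
  set T : Set E := {s ∈ S | π s ≠ π x} with hT
  have hTf : T.Finite := hS.subset fun s hs => hs.1
  have hx : π x ∉ convexHull ℝ (π '' T) := by
    have himg := LinearMap.image_convexHull (π : E →ₗ[ℝ] E) T
    rw [ContinuousLinearMap.coe_coe] at himg
    rw [← himg]
    rintro ⟨z, hz, hzx⟩
    have hTsub : T ⊆ convexHull ℝ S \ segment ℝ x y := fun s hs =>
      ⟨subset_convexHull ℝ S hs.1, fun hs' => hs.2 (hconst s hs')⟩
    have hz' := convexHull_min hTsub (h.convex_sdiff (convex_convexHull ℝ S)) hz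
    exact hz'.2 (hfib z hz'.1 hzx)
  obtain ⟨f, r, hr, hfT⟩ := geometric_hahn_banach_point_closed (convex_convexHull ℝ _)
    ((hTf.image π).isClosed_convexHull ℝ) hx
  refine ⟨f, fun z hz => ?_⟩
  have hconv : Convex ℝ {z : E | π z = π x ∨ f (π x) < f (π z)} := by
    have key : ∀ z, (π z = π x ∨ f (π x) < f (π z)) → f (π x) ≤ f (π z) := by
      rintro z (hz | hz)
      · rw [hz]
      · exact hz.le
    rw [convex_iff_forall_pos]
    intro p hp q hq a b ha hb hab
    have hp' := key p hp
    have hq' := key q hq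
    have hb' : b = 1 - a := by linarith
    simp only [Set.mem_ofPred_eq] at hp hq ⊢
    rcases hp with hp | hp
    · rcases hq with hq | hq
      · left
        rw [map_add, map_smul, map_smul, hp, hq, ← add_smul, hab, one_smul]
      · right
        simp only [map_add, map_smul, smul_eq_mul]
        subst hb'
        nlinarith
    · right
      simp only [map_add, map_smul, smul_eq_mul]
      subst hb'
      nlinarith
  refine convexHull_min (fun s hs => ?_) hconv hz
  by_cases hsx : π s = π x
  · exact Or.inl hsx
  · exact Or.inr (hr.trans (hfT _ (subset_convexHull ℝ _ ⟨s, ⟨hs, hsx⟩, rfl⟩)))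

/-- Every edge of a summand of a Minkowski sum of polytopes is parallel to an edge of the sum. -/
lemma exists_parallel_edge_sum {S : ι → Set E} (hS : ∀ i, (S i).Finite)
    (hne : ∀ i, (S i).Nonempty) {j : ι} {x y : E} (hxy : x ≠ y)
    (h : IsExtreme ℝ (convexHull ℝ (S j)) (segment ℝ x y)) :
    ∃ a b, a ≠ b ∧ IsExtreme ℝ (∑ i, convexHull ℝ (S i)) (segment ℝ a b) ∧
      b - a ∈ Submodule.span ℝ {y - x} := by
  have hd : y - x ≠ 0 := sub_ne_zero.2 hxy.symm
  obtain ⟨e, he⟩ := SeparatingDual.exists_eq_one (R := ℝ) hd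
  obtain ⟨π, hπ⟩ : ∃ π : E →L[ℝ] E, ∀ z, π z = z - e z • (y - x) :=
    ⟨ContinuousLinearMap.id ℝ E - e.smulRight (y - x), fun z => by simp⟩
  have hker : ∀ z, π z = 0 ↔ z ∈ Submodule.span ℝ {y - x} := by
    intro z
    rw [hπ, sub_eq_zero, Submodule.mem_span_singleton]
    refine ⟨fun hz => ⟨e z, hz.symm⟩, ?_⟩
    rintro ⟨t, rfl⟩
    rw [map_smul, he, smul_eq_mul, mul_one]
  obtain ⟨f, hf⟩ := exists_functional_of_edge (hS j) h π hker
  have hyx : π y = π x := by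
    rw [← sub_eq_zero, ← map_sub, hker]
    exact Submodule.mem_span_singleton_self _
  set P : Set E := ∑ i, convexHull ℝ (S i) with hP
  have hPS : P = convexHull ℝ (∑ i, S i) := (convexHull_sum _ _).symm
  have hPc : Convex ℝ P := hPS ▸ convex_convexHull ℝ _
  have hPk : IsCompact P := by
    rw [hPS]
    refine (((Set.Finite.pi' hS).image fun q => ∑ i, q i).subset ?_).isCompact_convexHull ℝ
    intro z hz
    obtain ⟨q, hq, hqz⟩ := (Set.mem_fintype_sum _ _).1 hz
    exact ⟨q, hq, hqz⟩
  choose q hq using fun i => (hne i).mono (subset_convexHull ℝ (S i))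
  have hPn : P.Nonempty := ⟨∑ i, q i, (Set.mem_fintype_sum _ _).2 ⟨q, hq, rfl⟩⟩
  set g : StrongDual ℝ E := f.comp π with hg
  obtain ⟨z₁, hz₁, hz₁min⟩ := hPk.exists_isMinOn hPn g.continuous.continuousOn
  set M : Set E := {z ∈ P | g z ≤ g z₁} with hM
  have hMext : IsExtreme ℝ P M := by
    refine ⟨fun z hz => hz.1, fun a ha b hb z hz hab => ⟨ha, ?_⟩⟩
    obtain ⟨s, t, hs, ht, hst, rfl⟩ := hab
    have h1 := hz.2
    have h2 : g z₁ ≤ g b := hz₁min hb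
    simp only [map_add, map_smul, smul_eq_mul] at h1
    have hs' : s = 1 - t := by linarith
    subst hs'
    by_contra! hlt
    nlinarith
  have hMc : Convex ℝ M :=
    hPc.inter (convex_halfSpace_le g.toLinearMap.isLinear (g z₁))
  have hMk : IsCompact M :=
    hPk.inter_right (isClosed_le g.continuous continuous_const)
  obtain ⟨w, hw⟩ := (hMk.image π.continuous).extremePoints_nonempty ⟨_, z₁, ⟨hz₁, le_rfl⟩, rfl⟩
  set F : Set E := {z ∈ M | π z = w} with hF
  have hFext : IsExtreme ℝ P F := hMext.trans (isExtreme_fiber π hw)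
  have hFc : Convex ℝ F :=
    hMc.inter ((convex_singleton w).linear_preimage (π : E →ₗ[ℝ] E))
  have hFk : IsCompact F :=
    hMk.inter_right (isClosed_eq π.continuous continuous_const)
  obtain ⟨z₀, hz₀, hz₀w⟩ := hw.1
  obtain ⟨r, hr, hrz⟩ := (Set.mem_fintype_sum _ _).1 hz₀.1
  have hx := h.subset (left_mem_segment ℝ x y)
  have hy := h.subset (right_mem_segment ℝ x y)
  have hrx : π (r j) = π x := by
    refine (hf (r j) (hr j)).resolve_right fun hlt => ?_
    have h1 : g z₁ ≤ _ := hz₁min (sum_sub_add_mem_sum hr j hx)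
    have h2 := hz₀.2
    rw [hrz, map_add, map_sub] at h1
    have h3 : g x < g (r j) := hlt
    linarith
  have hmem : ∀ a ∈ convexHull ℝ (S j), π a = π x → z₀ - r j + a ∈ F := by
    intro a ha hax
    have hπa : π (z₀ - r j + a) = π z₀ := by
      rw [map_add, map_sub, hrx, hax, sub_add_cancel]
    refine ⟨⟨hrz ▸ sum_sub_add_mem_sum hr j ha, ?_⟩, hπa.trans hz₀w⟩
    have : g (z₀ - r j + a) = g z₀ := congrArg f hπa
    rw [this]
    exact hz₀.2
  obtain ⟨a, b, hab, hFab, hba⟩ := exists_eq_segment_of_sub_mem_span hFk hFc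
    ⟨_, hmem x hx rfl, _, hmem y hy hyx, fun hxy' => hxy (add_left_cancel hxy')⟩ hd
    (fun a ha b hb => (hker _).1 (by rw [map_sub, ha.2, hb.2, sub_self]))
  exact ⟨a, b, hab, hFab ▸ hFext, hba⟩

end Edges

lemma demandSet_finite {n : ℕ} (A : Finset (Fin n → ℤ)) (u : (Fin n → ℤ) → ℝ)
    (p : Fin n → ℝ) : (demandSet A u p).Finite :=
  A.finite_toSet.subset fun _ ha => ha.1

lemma demandSet_nonempty {n : ℕ} {A : Finset (Fin n → ℤ)} (hA : A.Nonempty)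
    (u : (Fin n → ℤ) → ℝ) (p : Fin n → ℝ) : (demandSet A u p).Nonempty :=
  A.exists_max_image (fun a => u a - dotP p a) hA

lemma convexHull_aggDemand {n J : ℕ} (A : Fin J → Finset (Fin n → ℤ))
    (u : Fin J → (Fin n → ℤ) → ℝ) (p : Fin n → ℝ) :
    convexHull ℝ (intCoe '' aggDemand A u p) =
      ∑ j, convexHull ℝ (intCoe '' demandSet (A j) (u j) p) := by
  rw [← convexHull_sum]
  congr 1
  have hcoe : ∀ f : Fin J → Fin n → ℤ, intCoe (∑ j, f j) = ∑ j, intCoe (f j) := by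
    intro f
    ext i
    simp [intCoe]
  ext x
  rw [Set.mem_fintype_sum]
  constructor
  · rintro ⟨_, ⟨f, hf, rfl⟩, rfl⟩
    exact ⟨fun j => intCoe (f j), fun j => ⟨f j, hf j, rfl⟩, (hcoe f).symm⟩
  · rintro ⟨g, hg, rfl⟩
    choose f hf hfg using hg
    exact ⟨∑ j, f j, ⟨f, hf, rfl⟩, by rw [hcoe]; exact Finset.sum_congr rfl fun j _ => hfg j⟩

/-- If a nonzero multiple of `d` is parallel to a vector of `D`, then so is `d`. -/
lemma exists_parallel_of_mem_span {n : ℕ} {D : Set (Fin n → ℤ)} {c d : Fin n → ℝ} (hc : c ≠ 0)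
    (hcd : c ∈ Submodule.span ℝ {d}) (h : ∃ v ∈ D, ∃ t : ℝ, c = t • intCoe v) :
    ∃ v ∈ D, ∃ t : ℝ, d = t • intCoe v := by
  obtain ⟨v, hv, t, ht⟩ := h
  obtain ⟨s, rfl⟩ := Submodule.mem_span_singleton.1 hcd
  have hs : s ≠ 0 := fun hs => hc (by rw [hs, zero_smul])
  exact ⟨v, hv, s⁻¹ * t, by rw [mul_smul, ← ht, inv_smul_smul₀ hs]⟩

/-- the aggregate is of demand type `D` iff every individual utility is of demand
type `D`. -/
theorem stmt16 {n J : ℕ} (D : Set (Fin n → ℤ)) (hprim : ∀ v ∈ D, IsPrimitive v)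
    (A : Fin J → Finset (Fin n → ℤ)) (u : Fin J → (Fin n → ℤ) → ℝ)
    (hA : ∀ j, (A j).Nonempty) :
    (∀ p : Fin n → ℝ, EdgesParallelTo (convexHull ℝ (intCoe '' aggDemand A u p)) D) ↔
      (∀ j, IsDemandType (A j) (u j) D) := by
  simp only [convexHull_aggDemand]
  constructor
  · intro h j p x y hxy hext
    obtain ⟨a, b, hab, hab', hba⟩ := exists_parallel_edge_sum
      (S := fun j => intCoe '' demandSet (A j) (u j) p)
      (fun j => (demandSet_finite _ _ _).image _)
      (fun j => (demandSet_nonempty (hA j) _ _).image _) hxy hext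
    exact exists_parallel_of_mem_span (sub_ne_zero.2 hab.symm) hba (h p a b hab hab')
  · intro h p x y hxy hext
    obtain ⟨j, a, b, hab, hab', hba⟩ := exists_parallel_edge_summand
      (fun j => convex_convexHull ℝ _)
      (fun j => ((demandSet_finite _ _ _).image _).isCompact_convexHull ℝ) hxy hext
    exact exists_parallel_of_mem_span (sub_ne_zero.2 hab.symm) hba (h j p a b hab hab')
end
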